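/- arXiv:1007.1371 — 12 statements merged into one kernel-verified Lean document; each statement's English description precedes it below -/
import Mathlib

section
/- For every even (indeed every) n ≥ 1 and every state (L, R) over the deck {1, …, n}, some final state is reachable from (L, R). In other words, the game graph of the one-suit game of War has no wandering vertices: from any distribution of the cards between the two players' hands it is possible to finish the game in finitely many moves. -/
/-- A game state: the hands of the left and right player. -/
abbrev WarState := List ℕ × List ℕ

/-- A state is final if one of the players has no cards. -/
def Final (s : WarState) : Prop := s.1 = [] ∨ s.2 = []

/-- The move relation of the one-suit game of War: the players reveal their top
cards, and the player with the higher card places both at the bottom of his hand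
in either of the two possible orders. -/
inductive Move : WarState → WarState → Prop
  | leftOwnLast (a b : ℕ) (L R : List ℕ) (h : a > b) :
      Move (a :: L, b :: R) (L ++ [a, b], R)
  | leftRivalLast (a b : ℕ) (L R : List ℕ) (h : a > b) :
      Move (a :: L, b :: R) (L ++ [b, a], R)
  | rightOwnLast (a b : ℕ) (L R : List ℕ) (h : b > a) :
      Move (a :: L, b :: R) (L, R ++ [a, b])
  | rightRivalLast (a b : ℕ) (L R : List ℕ) (h : b > a) :
      Move (a :: L, b :: R) (L, R ++ [b, a])

/-- Reachability: the reflexive-transitive closure of the move relation. -/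
def Reachable : WarState → WarState → Prop := Relation.ReflTransGen Move

/-- A state is over the deck `{1, …, n}` if the two hands together form a
permutation of `[1, 2, …, n]`. -/
def OverDeck (n : ℕ) (s : WarState) : Prop := (s.1 ++ s.2).Perm (List.range' 1 n)

/-- Play one round, the first component telling whether the winner places the higher card first;
the resulting state is tagged with whether the left player won. Final states stay put. -/
def playRound : Bool × WarState → Bool × WarState
  | (o, (a :: L, b :: R)) =>
      if b < a then (true, (L ++ if o then [a, b] else [b, a], R))
      else (false, (L, R ++ if o then [b, a] else [a, b]))
  | (o, s) => (o, s)

/-- Two distinct cards placed in an order chosen by rank determine the order and the cards. -/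
theorem placement_injective {o o' : Bool} {x y x' y' : ℕ} {L L' : List ℕ} (h : y < x)
    (h' : y' < x')
    (e : (L ++ if o then [x, y] else [y, x]) = L' ++ if o' then [x', y'] else [y', x']) :
    o = o' ∧ x = x' ∧ y = y' ∧ L = L' := by
  obtain ⟨hL, hT⟩ := List.append_inj' e (by cases o <;> cases o' <;> rfl)
  cases o <;> cases o' <;> simp at hT <;> refine ⟨?_, ?_, ?_, hL⟩ <;> first | rfl | omega

theorem playRound_injOn {S : Set WarState} (hne : ∀ s ∈ S, ¬ Final s)
    (hnd : ∀ s ∈ S, (s.1 ++ s.2).Nodup) :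
    Set.InjOn playRound {p | p.2 ∈ S} := by
  rintro ⟨o, L, R⟩ hs ⟨o', L', R'⟩ hs' e
  have hf := hne _ hs
  have hf' := hne _ hs'
  have hd := hnd _ hs
  have hd' := hnd _ hs'
  rcases L with _ | ⟨a, L⟩
  · exact absurd (Or.inl rfl) hf
  rcases R with _ | ⟨b, R⟩
  · exact absurd (Or.inr rfl) hf
  rcases L' with _ | ⟨a', L'⟩
  · exact absurd (Or.inl rfl) hf'
  rcases R' with _ | ⟨b', R'⟩
  · exact absurd (Or.inr rfl) hf'
  have hab : a ≠ b := by rintro rfl; simp at hd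
  have hab' : a' ≠ b' := by rintro rfl; simp at hd'
  simp only [playRound] at e
  by_cases h : b < a <;> by_cases h' : b' < a' <;>
    simp only [h, h', if_true, if_false, Prod.mk.injEq, reduceCtorEq, false_and, true_and] at e
  · obtain ⟨rfl, rfl, rfl, rfl⟩ := placement_injective h h' e.1
    rw [e.2]
  · obtain ⟨rfl, rfl, rfl, rfl⟩ := placement_injective (by omega) (by omega) e.2
    rw [e.1]

theorem move_playRound (o : Bool) {s : WarState} (hf : ¬ Final s) (hd : (s.1 ++ s.2).Nodup) :
    Move s (playRound (o, s)).2 := by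
  obtain ⟨L, R⟩ := s
  rcases L with _ | ⟨a, L⟩
  · exact absurd (Or.inl rfl) hf
  rcases R with _ | ⟨b, R⟩
  · exact absurd (Or.inr rfl) hf
  have hab : a ≠ b := by rintro rfl; simp at hd
  by_cases h : b < a <;> cases o <;> simp only [playRound, h, if_true, if_false, Bool.false_eq_true]
  · exact .leftRivalLast a b L R h
  · exact .leftOwnLast a b L R h
  · exact .rightOwnLast a b L R (by omega)
  · exact .rightRivalLast a b L R (by omega)

theorem length_fst_playRound_of_left_wins {o : Bool} {s : WarState} (hf : ¬ Final s)
    (h : (playRound (o, s)).1 = true) :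
    (playRound (o, s)).2.1.length = s.1.length + 1 := by
  obtain ⟨L, R⟩ := s
  rcases L with _ | ⟨a, L⟩
  · exact absurd (Or.inl rfl) hf
  rcases R with _ | ⟨b, R⟩
  · exact absurd (Or.inr rfl) hf
  by_cases hlt : b < a
  · cases o <;> simp [playRound, hlt]
  · simp [playRound, hlt] at h

/-- A finite nonempty set of states with distinct cards that is closed under moves contains a
final state: otherwise `playRound` permutes it, so every state arises from a win of the left
player, contradicting minimality of the left hand. -/
theorem exists_final_of_finite_of_closed {S : Set WarState} (hfin : S.Finite) (hS : S.Nonempty)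
    (hclosed : ∀ s ∈ S, ∀ t, Move s t → t ∈ S) (hnd : ∀ s ∈ S, (s.1 ++ s.2).Nodup) :
    ∃ t ∈ S, Final t := by
  by_contra! hne
  obtain ⟨t, ht, hmin⟩ := Set.exists_min_image S (fun s => s.1.length) hfin hS
  have hfin' : {p : Bool × WarState | p.2 ∈ S}.Finite :=
    (Set.finite_univ.prod hfin).subset fun p hp => ⟨trivial, hp⟩
  have hmaps : Set.MapsTo playRound {p | p.2 ∈ S} {p | p.2 ∈ S} := fun p hp =>
    hclosed p.2 hp _ (move_playRound p.1 (hne _ hp) (hnd _ hp))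
  obtain ⟨⟨o, u⟩, hu, e⟩ :=
    ((hfin'.injOn_iff_bijOn_of_mapsTo hmaps).1 (playRound_injOn hne hnd)).surjOn (show (true, t) ∈ _ from ht)
  have hlen := length_fst_playRound_of_left_wins (hne u hu) (o := o) (by rw [e])
  rw [e] at hlen
  have := hmin u hu
  simp only at hlen this
  omega

theorem Move.perm {s t : WarState} (h : Move s t) : (t.1 ++ t.2).Perm (s.1 ++ s.2) := by
  rw [List.perm_iff_count]
  intro c
  cases h <;> simp [List.count_cons] <;> omega

theorem Reachable.perm {s t : WarState} (h : Reachable s t) :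
    (t.1 ++ t.2).Perm (s.1 ++ s.2) := by
  induction h with
  | refl => exact .refl _
  | tail _ hm ih => exact hm.perm.trans ih

theorem finite_setOf_append_perm (l : List ℕ) :
    {s : WarState | (s.1 ++ s.2).Perm l}.Finite := by
  refine (((List.finite_toSet l.permutations).prod (Set.finite_Iic l.length)).image
    fun p => (p.1.take p.2, p.1.drop p.2)).subset ?_
  rintro ⟨L, R⟩ h
  refine ⟨(L ++ R, L.length), ⟨List.mem_permutations.2 h, ?_⟩, by simp⟩
  have := List.Perm.length_eq h
  simp at this ⊢
  omega

/-- From any state over the deck `{1, …, n}` some final state is reachable: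
the game graph has no wandering vertices. -/
theorem war_no_wandering_vertices (n : ℕ) (hn : 1 ≤ n) (s : WarState)
    (hs : OverDeck n s) : ∃ t : WarState, Reachable s t ∧ Final t :=
  exists_final_of_finite_of_closed (S := {t | Reachable s t})
    ((finite_setOf_append_perm _).subset fun _ ht => Reachable.perm ht)
    ⟨s, Relation.ReflTransGen.refl⟩ (fun _ ht _ hm => Relation.ReflTransGen.tail ht hm)
    fun _ ht => ((Reachable.perm ht).trans hs).nodup_iff.2 List.nodup_range'
end

section
/- For every n there exists a natural number N such that from every state (L, R) over the deck {1, …, n} some final state is reachable in at most N moves (i.e., there is a chain of at most N moves from (L, R) ending in a final state). -/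
/-- `MovesIn k s t` means there is a chain of exactly `k` moves from `s` to `t`. -/
def MovesIn : ℕ → WarState → WarState → Prop
  | 0, s, t => s = t
  | k + 1, s, t => ∃ u, Move s u ∧ MovesIn k u t

theorem Move.overDeck {n : ℕ} {s t : WarState} (h : Move s t) (hs : OverDeck n s) :
    OverDeck n t := by
  refine List.Perm.trans ?_ hs
  rw [List.perm_iff_count]
  intro x
  cases h <;> simp [List.count_cons] <;> omega

theorem finite_setOf_overDeck (n : ℕ) : {s : WarState | OverDeck n s}.Finite := by
  refine ((((List.range' 1 n).permutations.finite_toSet).prod (Set.finite_Iic n)).image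
    fun p : List ℕ × ℕ => ((p.1.take p.2, p.1.drop p.2) : WarState)).subset ?_
  rintro ⟨L, R⟩ h
  refine ⟨(L ++ R, L.length), ⟨List.mem_permutations.2 h, ?_⟩, by simp⟩
  have := List.Perm.length_eq h
  simp at this
  simp
  omega

/-- The state after one move, where the flag tells in which order the two cards are returned,
together with a flag that is `true` when the left player has won the trick. -/
def playTrick : WarState × Bool → WarState × Bool
  | ((a :: L, b :: R), c) =>
    if b < a then ((L ++ bif c then [a, b] else [b, a], R), true)
    else ((L, R ++ bif c then [a, b] else [b, a]), false)
  | x => x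

theorem OverDeck.head_ne {n a b : ℕ} {L R : List ℕ} (h : OverDeck n (a :: L, b :: R)) :
    a ≠ b := by
  have := (List.Perm.nodup_iff h).2 List.nodup_range'
  rintro rfl
  simp at this

theorem move_playTrick {n : ℕ} {s : WarState} (hs : OverDeck n s) (hf : ¬ Final s) (c : Bool) :
    Move s (playTrick (s, c)).1 := by
  obtain ⟨_ | ⟨a, L⟩, _ | ⟨b, R⟩⟩ := s <;> simp [Final] at hf
  rcases lt_or_gt_of_ne hs.head_ne with h | h
  · cases c <;> simp only [playTrick, h.not_gt, if_false, cond_true, cond_false]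
    · exact .rightRivalLast a b L R h
    · exact .rightOwnLast a b L R h
  · cases c <;> simp only [playTrick, h, if_true, cond_true, cond_false]
    · exact .leftRivalLast a b L R h
    · exact .leftOwnLast a b L R h

theorem injOn_playTrick (n : ℕ) :
    Set.InjOn playTrick ({s | OverDeck n s ∧ ¬ Final s} ×ˢ Set.univ) := by
  rintro ⟨⟨_ | ⟨a, L⟩, _ | ⟨b, R⟩⟩, c⟩ ⟨⟨h, hf⟩, -⟩ ⟨⟨_ | ⟨a', L'⟩, _ | ⟨b', R'⟩⟩, c'⟩
    ⟨⟨h', hf'⟩, -⟩ heq <;> simp [Final] at hf hf'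
  have hab := OverDeck.head_ne h
  have hab' := OverDeck.head_ne h'
  simp only [playTrick] at heq
  split_ifs at heq <;> simp only [Prod.mk.injEq] at heq
  · obtain ⟨h1, h2⟩ := List.append_inj' heq.1.1 (by cases c <;> cases c' <;> rfl)
    cases c <;> cases c' <;> simp at h2 <;> grind
  · simp at heq
  · simp at heq
  · obtain ⟨h1, h2⟩ := List.append_inj' heq.1.2 (by cases c <;> cases c' <;> rfl)
    cases c <;> cases c' <;> simp at h2 <;> grind

theorem length_fst_of_playTrick_eq {s t : WarState} {c : Bool} (hf : ¬ Final s)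
    (h : playTrick (s, c) = (t, true)) : t.1.length = s.1.length + 1 := by
  obtain ⟨_ | ⟨a, L⟩, _ | ⟨b, R⟩⟩ := s <;> simp [Final] at hf
  simp only [playTrick] at h
  split_ifs at h <;> simp only [Prod.mk.injEq] at h
  · rw [← h.1]
    cases c <;> simp
  · simp at h

/-- A set of non-final states over a fixed deck that is closed under moves is empty: on such a
finite set `playTrick` is a bijection, so tricks won by the left player can be undone forever,
while each of them undone shortens the left hand. -/
theorem eq_empty_of_closed_of_not_final {n : ℕ} {S : Set WarState}
    (hS : ∀ s ∈ S, OverDeck n s ∧ ¬ Final s) (hcl : ∀ s ∈ S, ∀ t, Move s t → t ∈ S) :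
    S = ∅ := by
  by_contra hne
  obtain ⟨t, ht, hmin⟩ := WellFounded.has_min
    (measure fun s : WarState => s.1.length).wf S (Set.nonempty_iff_ne_empty.2 hne)
  have hfin : (S ×ˢ (Set.univ : Set Bool)).Finite :=
    ((finite_setOf_overDeck n).subset fun s hs => (hS s hs).1).prod Set.finite_univ
  have hinj : Set.InjOn playTrick (S ×ˢ Set.univ) :=
    (injOn_playTrick n).mono (Set.prod_mono hS le_rfl)
  have hmaps : Set.MapsTo playTrick (S ×ˢ Set.univ) (S ×ˢ Set.univ) := fun x hx =>
    ⟨hcl _ hx.1 _ (move_playTrick (hS _ hx.1).1 (hS _ hx.1).2 _), Set.mem_univ _⟩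
  have hsurj : Set.SurjOn playTrick (S ×ˢ Set.univ) (S ×ˢ Set.univ) :=
    ((hfin.injOn_iff_bijOn_of_mapsTo hmaps).1 hinj).surjOn
  obtain ⟨⟨s, c⟩, ⟨hs, -⟩, hst⟩ := hsurj (show (t, true) ∈ S ×ˢ Set.univ from ⟨ht, trivial⟩)
  have hlen := length_fst_of_playTrick_eq (hS s hs).2 hst
  exact hmin s hs (show s.1.length < t.1.length by omega)

theorem exists_movesIn_final {n : ℕ} {s : WarState} (hs : OverDeck n s) :
    ∃ k t, MovesIn k s t ∧ Final t := by
  by_contra hcon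
  have hempty := eq_empty_of_closed_of_not_final (n := n)
    (S := {s | OverDeck n s ∧ ¬ ∃ k t, MovesIn k s t ∧ Final t})
    (fun s hs => ⟨hs.1, fun hf => hs.2 ⟨0, s, rfl, hf⟩⟩)
    (fun s hs u hu => ⟨hu.overDeck hs.1, fun ⟨k, t, hk, hf⟩ =>
      hs.2 ⟨k + 1, t, ⟨u, hu, hk⟩, hf⟩⟩)
  exact Set.notMem_empty s (hempty ▸ ⟨hs, hcon⟩)

/-- For every `n` there is a uniform bound `N` such that from every state over the
deck `{1, …, n}` a final state is reachable in at most `N` moves. -/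
theorem war_uniform_bound (n : ℕ) :
    ∃ N : ℕ, ∀ s : WarState, OverDeck n s →
      ∃ k ≤ N, ∃ t : WarState, MovesIn k s t ∧ Final t := by
  choose! k hk using fun s (hs : OverDeck n s) => exists_movesIn_final hs
  obtain ⟨N, hN⟩ := ((finite_setOf_overDeck n).image k).bddAbove
  exact ⟨N, fun s hs => ⟨k s, hN (Set.mem_image_of_mem k hs), hk s hs⟩⟩
end

section
/- There exists a non-final state (L, R) over the deck {1, …, 6} and a natural number k ≥ 1 such that applying the deterministic step f (in which the left player's card is always placed at the bottom of the winner's hand before the right player's card) k times to (L, R) returns the state (L, R); that is, with this fixed rule the game can cycle forever. -/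
/-- The deterministic step in which the left player's card is always returned to
the bottom of the winner's hand before the right player's card; final states are
fixed. -/
def fstep : WarState → WarState
  | ([], R) => ([], R)
  | (L, []) => (L, [])
  | (a :: L, b :: R) =>
      if a > b then (L ++ [a, b], R)
      else if b > a then (L, R ++ [a, b])
      else (a :: L, b :: R)

/-- With the fixed returning rule the game can cycle forever: there is a
non-final state over the deck `{1, …, 6}` that returns to itself after `k ≥ 1`
deterministic steps. -/
theorem war_cycle_exists :
    ∃ s : WarState, ¬ Final s ∧ OverDeck 6 s ∧ ∃ k : ℕ, 1 ≤ k ∧ fstep^[k] s = s := by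
  refine ⟨([1, 4, 2], [5, 3, 6]), ?_, ?_, 12, by norm_num, by decide⟩
  · simp [Final]
  · unfold OverDeck
    decide
end

section
/- There exists a non-final state (L, R) with |L| = |R| = 26 whose combined list of card values L ++ R is a permutation of the multiset in which each value 2, 3, …, 14 occurs exactly four times (a standard 52-card pack tracked by values), such that along the orbit of (L, R) under the deterministic step f the two top cards compared at every move have different values (so 'war' never occurs and f is always defined), and f applied 26 times to (L, R) returns (L, R). Hence a never-ending game with the fixed rule is possible with a standard deck. -/
/-- The multiset of values of a standard 52-card pack: each value `2, …, 14`
occurs exactly four times. -/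
def standardPackValues : List ℕ := (List.range' 2 13).flatMap (fun v => List.replicate 4 v)

/-- If the orbit of `s` is periodic with period `n > 0`, then a property of states that holds along
the first `n` states of the orbit holds along the whole orbit. -/
theorem forall_iterate_of_isPeriodicPt {α : Type*} {f : α → α} {s : α} {n : ℕ} (hn : 0 < n)
    (hs : Function.IsPeriodicPt f n s) {P : α → Prop} (h : ∀ j < n, P (f^[j] s)) (j : ℕ) :
    P (f^[j] s) := by
  rw [← hs.iterate_mod_apply j]
  exact h _ (Nat.mod_lt j hn)

/-- The left hand of a recurring deal: pairs `y, x` with `x < y`. -/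
def cyclingLeftHand : List ℕ :=
  [8, 2, 9, 2, 9, 3, 10, 3, 10, 4, 11, 4, 11, 5, 12, 5, 12, 6, 13, 6, 13, 7, 14, 7, 14, 8]

/-- The right hand of a recurring deal: the pairs of the left hand, reversed. -/
def cyclingRightHand : List ℕ :=
  [2, 8, 2, 9, 3, 9, 3, 10, 4, 10, 4, 11, 5, 11, 5, 12, 6, 12, 6, 13, 7, 13, 7, 14, 8, 14]

theorem isPeriodicPt_fstep_cyclingHands :
    Function.IsPeriodicPt fstep 26 (cyclingLeftHand, cyclingRightHand) := by
  change fstep^[26] (cyclingLeftHand, cyclingRightHand) = (cyclingLeftHand, cyclingRightHand)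
  decide

theorem head?_ne_head?_of_iterate_cyclingHands :
    ∀ j < 26, let s := fstep^[j] (cyclingLeftHand, cyclingRightHand)
      s.1 ≠ [] ∧ s.2 ≠ [] ∧ s.1.head? ≠ s.2.head? := by
  decide

theorem exists_cons_of_head?_ne {s : WarState}
    (h : s.1 ≠ [] ∧ s.2 ≠ [] ∧ s.1.head? ≠ s.2.head?) :
    ∃ a b : ℕ, ∃ L' R' : List ℕ, s = (a :: L', b :: R') ∧ a ≠ b := by
  obtain ⟨_ | ⟨a, L'⟩, _ | ⟨b, R'⟩⟩ := s <;> simp_all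

/-- A never-ending game with a standard 52-card deck: there is a state with 26
cards in each hand, whose combined values form a standard pack, such that along
the whole orbit of the deterministic step the two compared top cards always have
different values (so `war` never occurs), and the state recurs after 26 steps. -/
theorem war_cycle_standard_deck :
    ∃ L R : List ℕ, L.length = 26 ∧ R.length = 26 ∧
      (L ++ R).Perm standardPackValues ∧
      (∀ j : ℕ, ∃ a b : ℕ, ∃ L' R' : List ℕ,
        fstep^[j] (L, R) = (a :: L', b :: R') ∧ a ≠ b) ∧
      fstep^[26] (L, R) = (L, R) := by
  refine ⟨cyclingLeftHand, cyclingRightHand, rfl, rfl, by decide, fun j => ?_,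
    isPeriodicPt_fstep_cyclingHands⟩
  exact exists_cons_of_head?_ne (forall_iterate_of_isPeriodicPt (by norm_num)
    isPeriodicPt_fstep_cyclingHands
    (P := fun s => s.1 ≠ [] ∧ s.2 ≠ [] ∧ s.1.head? ≠ s.2.head?)
    head?_ne_head?_of_iterate_cyclingHands j)
end

section
/- Every state (L, R) whose combined list L ++ R has no duplicate entries and in which both players have at least two cards (|L| ≥ 2 and |R| ≥ 2) has exactly two distinct predecessors: one in which the left player won the preceding play and one in which the right player won it. -/
theorem exists_eq_append_pair {α : Type*} {l : List α} (h : 2 ≤ l.length) :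
    ∃ l₀ x y, l = l₀ ++ [x, y] := by
  refine ⟨l.take (l.length - 2), ?_⟩
  obtain ⟨x, y, hxy⟩ := List.length_eq_two.mp
    (show (l.drop (l.length - 2)).length = 2 by rw [List.length_drop]; omega)
  exact ⟨x, y, by rw [← hxy, List.take_append_drop]⟩

/-- A play that ends in `(L ++ [x, y], R ++ [z, w])` moved either `x` and `y` or `z` and `w`, and
the comparison of the two moved cards tells who played which. -/
theorem move_append_pair_iff {L R : List ℕ} {x y z w : ℕ} (hxy : x ≠ y) (hzw : z ≠ w)
    (t : WarState) :
    Move t (L ++ [x, y], R ++ [z, w]) ↔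
      t = (max x y :: L, min x y :: (R ++ [z, w])) ∨
        t = (min z w :: (L ++ [x, y]), max z w :: R) := by
  constructor
  · intro h
    generalize hs : ((L ++ [x, y], R ++ [z, w]) : WarState) = s at h
    cases h with
    | leftOwnLast a b L' R' h =>
      obtain ⟨h₁, rfl⟩ := Prod.mk.inj hs
      obtain ⟨rfl, h₂⟩ := List.append_inj' h₁ rfl
      obtain ⟨rfl, rfl⟩ : x = a ∧ y = b := by simpa using h₂
      left; rw [max_eq_left h.le, min_eq_right h.le]
    | leftRivalLast a b L' R' h =>
      obtain ⟨h₁, rfl⟩ := Prod.mk.inj hs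
      obtain ⟨rfl, h₂⟩ := List.append_inj' h₁ rfl
      obtain ⟨rfl, rfl⟩ : x = b ∧ y = a := by simpa using h₂
      left; rw [max_eq_right h.le, min_eq_left h.le]
    | rightOwnLast a b L' R' h =>
      obtain ⟨rfl, h₁⟩ := Prod.mk.inj hs
      obtain ⟨rfl, h₂⟩ := List.append_inj' h₁ rfl
      obtain ⟨rfl, rfl⟩ : z = a ∧ w = b := by simpa using h₂
      right; rw [max_eq_right h.le, min_eq_left h.le]
    | rightRivalLast a b L' R' h =>
      obtain ⟨rfl, h₁⟩ := Prod.mk.inj hs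
      obtain ⟨rfl, h₂⟩ := List.append_inj' h₁ rfl
      obtain ⟨rfl, rfl⟩ : z = b ∧ w = a := by simpa using h₂
      right; rw [max_eq_left h.le, min_eq_right h.le]
  · rintro (rfl | rfl)
    · rcases hxy.lt_or_gt with h | h
      · rw [max_eq_right h.le, min_eq_left h.le]; exact .leftRivalLast _ _ _ _ h
      · rw [max_eq_left h.le, min_eq_right h.le]; exact .leftOwnLast _ _ _ _ h
    · rcases hzw.lt_or_gt with h | h
      · rw [max_eq_right h.le, min_eq_left h.le]; exact .rightOwnLast _ _ _ _ h
      · rw [max_eq_left h.le, min_eq_right h.le]; exact .rightRivalLast _ _ _ _ h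

/-- If both players have at least two cards (and all cards are distinct), the
state has exactly two distinct predecessors: one in which the left player won
the preceding play (his hand was one card shorter) and one in which the right
player won it. -/
theorem war_two_predecessors (L R : List ℕ) (hnodup : (L ++ R).Nodup)
    (hL : 2 ≤ L.length) (hR : 2 ≤ R.length) :
    ∃ tL tR : WarState, tL ≠ tR ∧
      {t : WarState | Move t (L, R)} = {tL, tR} ∧
      tL.1.length + 1 = L.length ∧   -- the left player won the play leading to `(L, R)`
      tR.2.length + 1 = R.length := by  -- the right player won the play leading to `(L, R)`
  obtain ⟨L, x, y, rfl⟩ := exists_eq_append_pair hL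
  obtain ⟨R, z, w, rfl⟩ := exists_eq_append_pair hR
  have hxy : x ≠ y := by
    simpa using (List.nodup_append.mp (List.nodup_append.mp hnodup).1).2.1
  have hzw : z ≠ w := by
    simpa using (List.nodup_append.mp (List.nodup_append.mp hnodup).2.1).2.1
  refine ⟨(max x y :: L, min x y :: (R ++ [z, w])),
    (min z w :: (L ++ [x, y]), max z w :: R), ?_, ?_, by simp, by simp⟩
  · intro h
    simpa using congrArg (fun t : WarState => t.1.length) h
  · ext t
    exact move_append_pair_iff hxy hzw t
end

section
/- (Back-tracking lemma.) Every state (L, R) whose combined list L ++ R has no duplicate entries and with |L| ≥ 2 has a predecessor (L', R') in which the left player won the preceding play; in particular |L'| = |L| − 1, so one can always back-track through a play won by the left player, strictly decreasing the size of the left player's hand. -/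
/-- Back-tracking lemma: a state with `|L| ≥ 2` (all cards distinct) has a
predecessor in which the left player won the preceding play, i.e. a predecessor
`(L', R')` with `|L'| = |L| − 1`. -/
theorem war_backtrack (L R : List ℕ) (hnodup : (L ++ R).Nodup)
    (hL : 2 ≤ L.length) :
    ∃ L' R' : List ℕ, Move (L', R') (L, R) ∧ L'.length + 1 = L.length := by
  obtain ⟨M, x, y, rfl⟩ : ∃ (M : List ℕ) (x y : ℕ), L = M ++ [x, y] := by
    rcases L.eq_nil_or_concat with rfl | ⟨K, y, rfl⟩
    · simp at hL
    · rcases K.eq_nil_or_concat with rfl | ⟨M, x, rfl⟩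
      · simp at hL
      · exact ⟨M, x, y, by simp⟩
  have hxy : x ≠ y := by
    have h := ((List.nodup_append.mp hnodup).1.of_append_right)
    simpa using h
  rcases hxy.lt_or_gt with h | h
  · exact ⟨y :: M, x :: R, .leftRivalLast y x M R h, by simp⟩
  · exact ⟨x :: M, y :: R, .leftOwnLast x y M R h, by simp⟩
end

section
/- The highest card never changes hands: if m is strictly greater than every other entry of L ++ R and m is an entry of L, then for every state (L₁, R₁) reachable from (L, R) by one move, m is an entry of L₁. -/
/-- The highest card never changes hands: if `m` is strictly greater than every
other card and is in the left player's hand, it is still there after any move. -/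
theorem war_highest_card_stays (L R L₁ R₁ : List ℕ) (m : ℕ)
    (hmax : ∀ x ∈ L ++ R, x ≠ m → x < m) (hm : m ∈ L)
    (hmove : Move (L, R) (L₁, R₁)) : m ∈ L₁ := by
  have hle : ∀ x ∈ L ++ R, x ≤ m := fun x hx => by
    by_cases h : x = m
    · exact h.le
    · exact (hmax x hx h).le
  cases hmove with
  | leftOwnLast a b L' _ h =>
    rcases List.mem_cons.1 hm with rfl | hm <;> simp [*]
  | leftRivalLast a b L' _ h =>
    rcases List.mem_cons.1 hm with rfl | hm <;> simp [*]
  | rightOwnLast a b _ R' h | rightRivalLast a b _ R' h =>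
    rcases List.mem_cons.1 hm with rfl | hm
    · exact absurd (hle b (by simp)) (not_le.2 h)
    · exact hm
end

section
/- The player holding the highest card never loses: if m is strictly greater than every other entry of L ++ R and m is an entry of L, then no state of the form ([], R₁) is reachable from (L, R). -/
/-- A move preserves the property that all cards are at most `m` and that `m` is in the
left player's hand. -/
theorem Move.mem_left_and_le {m : ℕ} {s t : WarState} (hst : Move s t)
    (hs : m ∈ s.1 ∧ ∀ x ∈ s.1 ++ s.2, x ≤ m) :
    m ∈ t.1 ∧ ∀ x ∈ t.1 ++ t.2, x ≤ m := by
  obtain ⟨hmem, hle⟩ := hs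
  cases hst with
  | leftOwnLast a b L R h | leftRivalLast a b L R h => grind
  | rightOwnLast a b L R h | rightRivalLast a b L R h =>
    have hb : b ≤ m := hle b (by simp)
    grind

/-- Reachability preserves the property that all cards are at most `m` and that `m` is in the
left player's hand. -/
theorem Reachable.mem_left_and_le {m : ℕ} {s t : WarState} (hst : Reachable s t)
    (hs : m ∈ s.1 ∧ ∀ x ∈ s.1 ++ s.2, x ≤ m) :
    m ∈ t.1 ∧ ∀ x ∈ t.1 ++ t.2, x ≤ m := by
  induction hst with
  | refl => exact hs
  | tail _ hmove ih => exact hmove.mem_left_and_le ih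

/-- The player holding the highest card never loses: if `m` is strictly greater
than every other card and is in the left player's hand, no state in which the
left player has no cards is reachable. -/
theorem war_highest_card_never_loses (L R : List ℕ) (m : ℕ)
    (hmax : ∀ x ∈ L ++ R, x ≠ m → x < m) (hm : m ∈ L) :
    ¬ ∃ R₁ : List ℕ, Reachable (L, R) ([], R₁) := by
  rintro ⟨R₁, hreach⟩
  have hle : ∀ x ∈ L ++ R, x ≤ m := fun x hx =>
    (eq_or_ne x m).elim le_of_eq fun hne => (hmax x hx hne).le
  exact List.not_mem_nil (Reachable.mem_left_and_le hreach ⟨hm, hle⟩).1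
end

section
/- In the modified game in which the lowest card beats the highest card, the outcome is not determined by the initial deal: for the deck {1, 2, 3, 4} there exists a state (L, R) with |L| = |R| = 2 from which both a final state of the form ([], R₁) and a final state of the form (L₁, []) are reachable, so either player can win from the same initial setting. -/
/-- In the modified game over the deck `{1, …, n}`, card `a` beats card `b` in
the usual order, except that the lowest card `1` beats the highest card `n`. -/
def Beats (n a b : ℕ) : Prop := (a = 1 ∧ b = n) ∨ (a > b ∧ ¬ (a = n ∧ b = 1))

/-- The move relation of the modified one-suit game of War over `{1, …, n}`. -/
inductive MoveMod (n : ℕ) : WarState → WarState → Prop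
  | leftOwnLast (a b : ℕ) (L R : List ℕ) (h : Beats n a b) :
      MoveMod n (a :: L, b :: R) (L ++ [a, b], R)
  | leftRivalLast (a b : ℕ) (L R : List ℕ) (h : Beats n a b) :
      MoveMod n (a :: L, b :: R) (L ++ [b, a], R)
  | rightOwnLast (a b : ℕ) (L R : List ℕ) (h : Beats n b a) :
      MoveMod n (a :: L, b :: R) (L, R ++ [a, b])
  | rightRivalLast (a b : ℕ) (L R : List ℕ) (h : Beats n b a) :
      MoveMod n (a :: L, b :: R) (L, R ++ [b, a])

/-- Reachability in the modified game. -/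
def ReachableMod (n : ℕ) : WarState → WarState → Prop :=
  Relation.ReflTransGen (MoveMod n)

/-- In the modified game in which the lowest card beats the highest one, the
outcome is not determined by the deal: for the deck `{1, 2, 3, 4}` there is an
initial state with two cards in each hand from which either player can win. -/
theorem war_modified_both_outcomes :
    ∃ L R : List ℕ, L.length = 2 ∧ R.length = 2 ∧
      (L ++ R).Perm (List.range' 1 4) ∧
      (∃ R₁ : List ℕ, ReachableMod 4 (L, R) ([], R₁)) ∧
      (∃ L₁ : List ℕ, ReachableMod 4 (L, R) (L₁, [])) := by
  have threeBeatsOne : MoveMod 4 ([1, 4], [3, 2]) ([4], [2, 1, 3]) :=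
    .rightOwnLast 1 3 [4] [2] (by simp [Beats])
  refine ⟨[1, 4], [3, 2], rfl, rfl, by decide, ⟨[4, 1, 2, 3], ?_⟩, ⟨[2, 1, 4, 3], ?_⟩⟩
  · have fourBeatsTwo : MoveMod 4 ([4], [2, 1, 3]) ([4, 2], [1, 3]) :=
      .leftOwnLast 4 2 [] [1, 3] (by simp [Beats])
    have oneBeatsFour : MoveMod 4 ([4, 2], [1, 3]) ([2], [3, 4, 1]) :=
      .rightOwnLast 4 1 [2] [3] (by simp [Beats])
    have threeBeatsTwo : MoveMod 4 ([2], [3, 4, 1]) ([], [4, 1, 2, 3]) :=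
      .rightOwnLast 2 3 [] [4, 1] (by simp [Beats])
    exact (((Relation.ReflTransGen.single threeBeatsOne).tail fourBeatsTwo).tail oneBeatsFour).tail
      threeBeatsTwo
  · have fourBeatsTwo : MoveMod 4 ([4], [2, 1, 3]) ([2, 4], [1, 3]) :=
      .leftRivalLast 4 2 [] [1, 3] (by simp [Beats])
    have twoBeatsOne : MoveMod 4 ([2, 4], [1, 3]) ([4, 2, 1], [3]) :=
      .leftOwnLast 2 1 [4] [3] (by simp [Beats])
    have fourBeatsThree : MoveMod 4 ([4, 2, 1], [3]) ([2, 1, 4, 3], []) :=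
      .leftOwnLast 4 3 [2, 1] [] (by simp [Beats])
    exact (((Relation.ReflTransGen.single threeBeatsOne).tail fourBeatsTwo).tail twoBeatsOne).tail
      fourBeatsThree
end

section
/- (Counting lemma for wandering vertices.) Let V be a finite type and r : V → V → Prop a relation. Call v a sink if there is no w with r v w, and let W be the set of vertices from which no sink is reachable (via the reflexive-transitive closure of r). Assume every non-sink vertex has exactly two successors (the set {w | r v w} has cardinality 2) and every vertex has at most two predecessors (the set {u | r u v} has cardinality at most 2). Then every vertex of W has exactly two predecessors, and every predecessor of a vertex of W lies in W (so W is an isolated subgraph: no edge enters W from outside). -/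
/-- In a finite directed graph with in-degrees at most `k`, a set of vertices closed under
successors whose vertices all have out-degree `k` has in-degree `k` at each of its vertices
and is closed under predecessors. -/
theorem ncard_pred_eq_and_pred_mem_of_succ_closed {V : Type*} [Finite V] {r : V → V → Prop}
    {k : ℕ} (hpred : ∀ v, {u | r u v}.ncard ≤ k) {W : Set V}
    (hclosed : ∀ v ∈ W, ∀ w, r v w → w ∈ W) (hsucc : ∀ v ∈ W, {w | r v w}.ncard = k) :
    ∀ v ∈ W, {u | r u v}.ncard = k ∧ ∀ u, r u v → u ∈ W := by
  classical
  have := Fintype.ofFinite V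
  have hout : ∀ v ∈ W.toFinset, (W.toFinset.bipartiteAbove r v).card = k := by
    intro v hv
    rw [Set.mem_toFinset] at hv
    rw [← hsucc v hv, ← Set.ncard_coe_finset]
    congr 1
    ext w
    simpa [Finset.mem_bipartiteAbove] using hclosed v hv w
  have hsub : ∀ v, (W.toFinset.bipartiteBelow r v : Set V) ⊆ {u | r u v} := by
    intro v u hu
    exact ((Finset.mem_bipartiteBelow r).mp (Finset.mem_coe.mp hu)).2
  have hle : ∀ v ∈ W.toFinset, (W.toFinset.bipartiteBelow r v).card ≤ k := by
    intro v _
    rw [← Set.ncard_coe_finset]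
    exact (Set.ncard_le_ncard (hsub v)).trans (hpred v)
  have hsum : ∑ v ∈ W.toFinset, (W.toFinset.bipartiteBelow r v).card = ∑ _v ∈ W.toFinset, k := by
    rw [← Finset.sum_card_bipartiteAbove_eq_sum_card_bipartiteBelow, Finset.sum_congr rfl hout]
  intro v hv
  have hin := (Finset.sum_eq_sum_iff_of_le hle).mp hsum v (Set.mem_toFinset.mpr hv)
  rw [← Set.ncard_coe_finset] at hin
  have heq := Set.eq_of_subset_of_ncard_le (hsub v) ((hpred v).trans hin.ge)
  refine ⟨heq ▸ hin, fun u hu => ?_⟩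
  have hmem : u ∈ (W.toFinset.bipartiteBelow r v : Set V) := heq ▸ hu
  exact Set.mem_toFinset.mp ((Finset.mem_bipartiteBelow r).mp (Finset.mem_coe.mp hmem)).1

/-- Counting lemma for wandering vertices: in a finite directed graph in which
every non-sink vertex has exactly two successors and every vertex has at most
two predecessors, every wandering vertex (one from which no sink is reachable)
has exactly two predecessors, and every predecessor of a wandering vertex is
itself wandering -- the wandering vertices form an isolated subgraph. -/
theorem wandering_isolated_subgraph {V : Type*} [Fintype V] (r : V → V → Prop)
    (hsucc : ∀ v : V, (∃ w, r v w) → {w : V | r v w}.ncard = 2)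
    (hpred : ∀ v : V, {u : V | r u v}.ncard ≤ 2)
    (W : Set V)
    (hW : W = {v : V | ¬ ∃ s, Relation.ReflTransGen r v s ∧ ∀ w, ¬ r s w}) :
    ∀ v ∈ W, {u : V | r u v}.ncard = 2 ∧ ∀ u : V, r u v → u ∈ W := by
  subst hW
  refine ncard_pred_eq_and_pred_mem_of_succ_closed hpred ?_ fun v hv => hsucc v ?_
  · rintro v hv w hvw ⟨s, hws, hs⟩
    exact hv ⟨s, .head hvw hws, hs⟩
  · by_contra! hsink
    exact hv ⟨v, .refl, hsink⟩
end

section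
/- (Abstract absorption criterion.) Let V be a finite type, r : V → V → Prop a relation, and ρ : V → ℕ. Assume: (i) every non-sink vertex has exactly two successors; (ii) every vertex has at most two predecessors; (iii) every vertex v having exactly two predecessors admits a predecessor u with ρ u < ρ v. Then from every vertex of V some sink is reachable (there are no wandering vertices). -/
open Finset in
/-- In a finite set `R` of vertices of a graph with in-degrees at most two, if every vertex of `R`
has exactly two successors and all of them lie in `R`, then every vertex of `R` has exactly two
predecessors and all of them lie in `R`. -/
theorem pred_of_succ_closed {V : Type*} [Fintype V] (r : V → V → Prop) (R : Finset V)
    (hclosed : ∀ v ∈ R, ∀ w, r v w → w ∈ R)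
    (hsucc : ∀ v ∈ R, {w : V | r v w}.ncard = 2)
    (hpred : ∀ v : V, {u : V | r u v}.ncard ≤ 2) :
    ∀ v ∈ R, {u : V | r u v}.ncard = 2 ∧ ∀ u, r u v → u ∈ R := by
  classical
  have hsub (v : V) : (R.bipartiteBelow r v : Set V) ⊆ {u | r u v} := fun u hu ↦ by
    simpa using (mem_bipartiteBelow r |>.1 hu).2
  have hle (v : V) : #(R.bipartiteBelow r v) ≤ {u : V | r u v}.ncard := by
    rw [← Set.ncard_coe_finset]
    exact Set.ncard_le_ncard (hsub v) (Set.toFinite _)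
  have habove : ∀ v ∈ R, #(R.bipartiteAbove r v) = 2 := fun v hv ↦ by
    rw [← hsucc v hv, ← Set.ncard_coe_finset]
    congr 1
    ext w
    simpa [bipartiteAbove] using hclosed v hv w
  have hsum : ∑ v ∈ R, #(R.bipartiteBelow r v) = ∑ _v ∈ R, 2 := by
    rw [← sum_card_bipartiteAbove_eq_sum_card_bipartiteBelow, sum_congr rfl habove]
  have hbelow := (sum_eq_sum_iff_of_le fun v _ ↦ (hle v).trans (hpred v)).1 hsum
  intro v hv
  have htwo : {u : V | r u v}.ncard = 2 := (hpred v).antisymm (hbelow v hv ▸ hle v)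
  refine ⟨htwo, fun u hu ↦ ?_⟩
  have heq := Set.eq_of_subset_of_ncard_le (hsub v)
    (by rw [Set.ncard_coe_finset, htwo, hbelow v hv]) (Set.toFinite _)
  have hmem : u ∈ (R.bipartiteBelow r v : Set V) := heq ▸ hu
  exact (mem_bipartiteBelow r |>.1 hmem).1

/-- Abstract absorption criterion: in a finite directed graph in which every
non-sink vertex has exactly two successors, every vertex has at most two
predecessors, and every vertex with exactly two predecessors has a predecessor
of strictly smaller rank `ρ`, a sink is reachable from every vertex (there are
no wandering vertices). -/
theorem absorption_criterion {V : Type*} [Fintype V] (r : V → V → Prop) (ρ : V → ℕ)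
    (hsucc : ∀ v : V, (∃ w, r v w) → {w : V | r v w}.ncard = 2)
    (hpred : ∀ v : V, {u : V | r u v}.ncard ≤ 2)
    (hdec : ∀ v : V, {u : V | r u v}.ncard = 2 → ∃ u, r u v ∧ ρ u < ρ v) :
    ∀ v : V, ∃ s : V, Relation.ReflTransGen r v s ∧ ∀ w, ¬ r s w := by
  classical
  intro v
  by_contra! hwander
  let R : Finset V := Finset.univ.filter (Relation.ReflTransGen r v)
  have hR (w : V) : w ∈ R ↔ Relation.ReflTransGen r v w := by simp [R]
  have hback := pred_of_succ_closed r R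
    (fun u hu w huw ↦ (hR w).2 (((hR u).1 hu).tail huw))
    (fun u hu ↦ hsucc u (hwander u ((hR u).1 hu))) hpred
  obtain ⟨w, hw, hmin⟩ := R.exists_min_image ρ ⟨v, (hR v).2 .refl⟩
  obtain ⟨htwo, hmem⟩ := hback w hw
  obtain ⟨u, huw, hlt⟩ := hdec w htwo
  exact (hmin u (hmem u huw)).not_gt hlt
end

section
/- For the deck {1, …, 6}, arbitrarily long games are possible: for every k there exist a state s₀ over the deck {1, …, 6} and a chain of states s₀, s₁, …, s_k with a move from sᵢ to sᵢ₊₁ for each i < k, in which no sᵢ is final. -/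
/-- A cycle of eight non-final states, each of which has a move to the next. -/
def warCycle : Fin 8 → WarState :=
  ![([1, 4, 5], [2, 6, 3]), ([4, 5], [6, 3, 2, 1]), ([5], [3, 2, 1, 4, 6]),
    ([5, 3], [2, 1, 4, 6]), ([3, 5, 2], [1, 4, 6]), ([5, 2, 3, 1], [4, 6]),
    ([2, 3, 1, 4, 5], [6]), ([3, 1, 4, 5], [6, 2])]

theorem move_warCycle (i : Fin 8) : Move (warCycle i) (warCycle (i + 1)) := by
  fin_cases i <;> first
    | exact Move.leftOwnLast _ _ _ _ (by decide)
    | exact Move.leftRivalLast _ _ _ _ (by decide)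
    | exact Move.rightOwnLast _ _ _ _ (by decide)
    | exact Move.rightRivalLast _ _ _ _ (by decide)

theorem not_final_warCycle (i : Fin 8) : ¬ Final (warCycle i) := by
  fin_cases i <;> simp [Final, warCycle]

/-- Arbitrarily long games are possible with the deck `{1, …, 6}`: for every `k`
there is a chain of `k` moves starting from a state over the deck in which no
state of the chain is final. -/
theorem war_arbitrarily_long_games :
    ∀ k : ℕ, ∃ s : ℕ → WarState, OverDeck 6 (s 0) ∧
      (∀ i < k, Move (s i) (s (i + 1))) ∧
      (∀ i ≤ k, ¬ Final (s i)) := by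
  intro k
  refine ⟨fun i => warCycle (Fin.ofNat 8 i), ?_, fun i _ => ?_, fun i _ => not_final_warCycle _⟩
  · unfold OverDeck
    decide
  · have h : Fin.ofNat 8 (i + 1) = Fin.ofNat 8 i + 1 := by
      simp [Fin.ext_iff, Fin.val_add]
    simpa only [h] using move_warCycle (Fin.ofNat 8 i)
end
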